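/- arXiv:1303.1427 — 4 statements merged into one kernel-verified Lean document; each statement's English description precedes it below -/
import Mathlib

section
/- Let X be a bounded G-lattice admitting a G-invariant measure μ (i.e. μ(g•a) = μ(a) for all g ∈ G, a ∈ X). Then for every n ≥ 1 the n-th subadditivity defect of the Protasov density at ⊤ vanishes: for every finite subset A ⊆ X with |A| ≤ n and ⋁A = ⊤, one has Σ_{a∈A} p_X(a) ≥ 1. -/
/-- `G = F·D`: every element of `G` is a product `f * d` with `f ∈ F`, `d ∈ D`. -/
def Covers {G : Type*} [Group G] (F D : Set G) : Prop :=
  ∀ g : G, ∃ f ∈ F, ∃ d ∈ D, g = f * d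

/-- The difference set `Δ(a) = {g ∈ G : (g • a) ⊓ a ≠ ⊥}`. -/
def deltaSet (G : Type*) [Group G] {X : Type*} [Lattice X] [BoundedOrder X]
    [MulAction G X] (a : X) : Set G :=
  {g : G | (g • a) ⊓ a ≠ ⊥}

/-- The covering number of `D ⊆ G`: the least cardinality of a finite `F ⊆ G`
with `G = F·D`, and `⊤` if no such finite `F` exists. -/
noncomputable def covNum (G : Type*) [Group G] (D : Set G) : ℕ∞ :=
  sInf {c : ℕ∞ | ∃ F : Finset G, (F.card : ℕ∞) = c ∧ Covers (↑F : Set G) D}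

/-- The Protasov density `p_X(a)`. -/
noncomputable def protasov (G : Type*) [Group G] {X : Type*} [Lattice X] [BoundedOrder X]
    [MulAction G X] (a : X) : ℝ :=
  if 0 < covNum G (deltaSet G a) ∧ covNum G (deltaSet G a) < ⊤ then
    1 / ((covNum G (deltaSet G a)).toNat : ℝ)
  else 0

/-- A measure on a bounded lattice `X`. -/
structure IsMeasure {X : Type*} [Lattice X] [BoundedOrder X] (μ : X → ℝ) : Prop where
  map_bot : μ ⊥ = 0
  map_top : μ ⊤ = 1
  mono : ∀ ⦃a b : X⦄, a ≤ b → μ a ≤ μ b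
  subadd : ∀ a b : X, μ (a ⊔ b) ≤ μ a + μ b
  additive : ∀ (k : ℕ) (f : Fin k → X), (∀ i j, i ≠ j → f i ⊓ f j = ⊥) →
    μ (Finset.univ.sup f) = ∑ i, μ (f i)

section GLattice

variable {G : Type*} [Group G] {X : Type*} [Lattice X] [BoundedOrder X] [MulAction G X]

theorem smul_bot_of_smul_inf (hinf : ∀ (g : G) (x y : X), g • (x ⊓ y) = g • x ⊓ g • y) (g : G) :
    g • (⊥ : X) = ⊥ := by
  have h := hinf g ⊥ (g⁻¹ • ⊥)
  rwa [bot_inf_eq, smul_inv_smul, inf_bot_eq] at h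

/-- Pairwise disjoint translates of `a` have total measure at most `1`. -/
theorem IsMeasure.card_mul_le_one {μ : X → ℝ} (hμ : IsMeasure μ)
    (hGinv : ∀ (g : G) (a : X), μ (g • a) = μ a) {a : X} {F : Finset G}
    (hF : ∀ x ∈ F, ∀ y ∈ F, x ≠ y → x • a ⊓ y • a = ⊥) : (F.card : ℝ) * μ a ≤ 1 := by
  have h := hμ.additive F.card (fun i => (F.equivFin.symm i : G) • a) fun i j hij =>
    hF _ (F.equivFin.symm i).2 _ (F.equivFin.symm j).2 fun h =>
      hij (F.equivFin.symm.injective (Subtype.ext h))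
  simp only [hGinv, Finset.sum_const, Finset.card_univ, Fintype.card_fin, nsmul_eq_mul] at h
  rw [← h, ← hμ.map_top]
  exact hμ.mono le_top

/-- If `a` has positive measure, a maximal family of pairwise disjoint translates of `a`
yields a finite cover of `G` by translates of `Δ(a)`. -/
theorem IsMeasure.exists_covers {μ : X → ℝ} (hμ : IsMeasure μ)
    (hinf : ∀ (g : G) (x y : X), g • (x ⊓ y) = g • x ⊓ g • y)
    (hGinv : ∀ (g : G) (a : X), μ (g • a) = μ a) {a : X} (ha : 0 < μ a) :
    ∃ F : Finset G, Covers (↑F : Set G) (deltaSet G a) ∧ (F.card : ℝ) * μ a ≤ 1 := by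
  classical
  by_contra! hno
  have hfam : ∀ k : ℕ, ∃ F : Finset G, F.card = k ∧
      ∀ x ∈ F, ∀ y ∈ F, x ≠ y → x • a ⊓ y • a = ⊥ := by
    intro k
    induction k with
    | zero => exact ⟨∅, by simp⟩
    | succ k ih =>
      obtain ⟨F, hk, hF⟩ := ih
      have hcov : ¬ Covers (↑F : Set G) (deltaSet G a) := fun h =>
        (hno F h).not_ge (hμ.card_mul_le_one hGinv hF)
      simp only [Covers, not_forall] at hcov
      obtain ⟨g, hg⟩ := hcov
      have hdisj : ∀ f ∈ F, g • a ⊓ f • a = ⊥ := by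
        intro f hf
        by_contra hne
        refine hg ⟨f, hf, f⁻¹ * g, fun h => hne ?_, by simp⟩
        have h' := congrArg (f • ·) h
        simpa [hinf, smul_smul, smul_bot_of_smul_inf hinf] using h'
      have hgF : g ∉ F := by
        intro hgF
        have h := hdisj g hgF
        rw [inf_idem] at h
        have h' := hGinv g a
        rw [h, hμ.map_bot] at h'
        exact ha.ne h'
      refine ⟨insert g F, by rw [Finset.card_insert_of_notMem hgF, hk], ?_⟩
      intro x hx y hy hxy
      rw [Finset.mem_insert] at hx hy
      rcases hx with rfl | hx <;> rcases hy with rfl | hy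
      · exact absurd rfl hxy
      · exact hdisj y hy
      · rw [inf_comm]
        exact hdisj x hx
      · exact hF x hx y hy hxy
  obtain ⟨k, hk⟩ := exists_nat_gt (1 / μ a)
  obtain ⟨F, rfl, hF⟩ := hfam k
  rw [div_lt_iff₀ ha] at hk
  exact hk.not_ge (hμ.card_mul_le_one hGinv hF)

theorem covNum_pos (D : Set G) : 0 < covNum G D := by
  refine zero_lt_one.trans_le (le_sInf ?_)
  rintro _ ⟨F, rfl, hF⟩
  obtain ⟨f, hf, -⟩ := hF 1
  exact_mod_cast Finset.card_pos.2 ⟨f, hf⟩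

theorem covNum_le_card {D : Set G} {F : Finset G} (hF : Covers (↑F : Set G) D) :
    covNum G D ≤ F.card :=
  sInf_le ⟨F, rfl, hF⟩

theorem protasov_nonneg (a : X) : 0 ≤ protasov G a := by
  unfold protasov
  split_ifs <;> positivity

/-- The Protasov density dominates every invariant measure. -/
theorem IsMeasure.le_protasov {μ : X → ℝ} (hμ : IsMeasure μ)
    (hinf : ∀ (g : G) (x y : X), g • (x ⊓ y) = g • x ⊓ g • y)
    (hGinv : ∀ (g : G) (a : X), μ (g • a) = μ a) (a : X) : μ a ≤ protasov G a := by
  rcases le_or_gt (μ a) 0 with ha | ha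
  · exact ha.trans (protasov_nonneg a)
  obtain ⟨F, hF, hle⟩ := hμ.exists_covers hinf hGinv ha
  have hcF := covNum_le_card hF
  have hpos := covNum_pos (deltaSet G a)
  have hlt : covNum G (deltaSet G a) < ⊤ := hcF.trans_lt (ENat.natCast_lt_top _)
  rw [protasov, if_pos ⟨hpos, hlt⟩]
  lift covNum G (deltaSet G a) to ℕ using hlt.ne with c
  rw [ENat.toNat_natCast, le_div_iff₀ (by exact_mod_cast hpos), mul_comm]
  have hc : (c : ℝ) ≤ F.card := by exact_mod_cast hcF
  exact (mul_le_mul_of_nonneg_right hc ha.le).trans hle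

end GLattice

theorem IsMeasure.finset_sup_le {X : Type*} [Lattice X] [BoundedOrder X] {μ : X → ℝ}
    (hμ : IsMeasure μ) (A : Finset X) : μ (A.sup id) ≤ ∑ a ∈ A, μ a := by
  classical
  induction A using Finset.induction_on with
  | empty => simp [hμ.map_bot]
  | insert a A ha ih =>
    rw [Finset.sup_insert, Finset.sum_insert ha, id]
    exact (hμ.subadd _ _).trans (by gcongr)

/-- If a bounded `G`-lattice admits a `G`-invariant measure, then for every `n ≥ 1`
the `n`-th subadditivity defect of the Protasov density at `⊤` vanishes: for every
finite `A ⊆ X` with `|A| ≤ n` and `⋁A = ⊤` one has `Σ_{a ∈ A} p_X(a) ≥ 1`. -/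
theorem amenable_defect_zero
    {G : Type*} [Group G] {X : Type*} [Lattice X] [BoundedOrder X] [MulAction G X]
    (hbt : (⊥ : X) ≠ ⊤)
    (hsup : ∀ (g : G) (x y : X), g • (x ⊔ y) = g • x ⊔ g • y)
    (hinf : ∀ (g : G) (x y : X), g • (x ⊓ y) = g • x ⊓ g • y)
    (μ : X → ℝ) (hμ : IsMeasure μ) (hGinv : ∀ (g : G) (a : X), μ (g • a) = μ a)
    (n : ℕ) (hn : 1 ≤ n) (A : Finset X) (hcard : A.card ≤ n) (hA : A.sup id = ⊤) :
    1 ≤ ∑ a ∈ A, protasov G a := by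
  rw [← hμ.map_top, ← hA]
  exact (hμ.finset_sup_le A).trans
    (Finset.sum_le_sum fun a _ => hμ.le_protasov hinf hGinv a)
end

section
/- Let X be a 0-distributive bounded G-lattice, n ≥ 1, and a : Fin n → X a function with a(i) ≠ ⊥ for every i and ⨆_{i∈Fin n} a(i) = ⊤. Define ℏ : Fin n → Cardinal by letting ℏ(i) be the least cardinality of a subset F ⊆ G with G = F·Δ(a(i)) (this least cardinal exists since Δ(a(i)) contains the identity, so F = G works). Then ℏ is not 0-generating. -/
/-- The indicator function `1_i : Fin n → ℕ` of `{i}`. -/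
def oneAt {n : ℕ} (i : Fin n) : Fin n → ℕ := fun j => if j = i then 1 else 0

/-- Pointwise sumset `Σ_{j ∈ Fin n} A j` of a family of sets of functions. -/
def sumset {n : ℕ} (A : Fin n → Set (Fin n → ℕ)) : Set (Fin n → ℕ) :=
  {x | ∃ a : Fin n → Fin n → ℕ, (∀ j, a j ∈ A j) ∧ x = ∑ j, a j}

/-- The strict lower cone `↓ℏ` of a cardinal-valued function `ℏ`. -/
def lowerConeC {n : ℕ} (h : Fin n → Cardinal) : Set (Fin n → ℕ) :=
  {g | ∀ i, (g i : Cardinal) < h i}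

/-- One step of the generation process: `{x - x(i)·1_i : x ∈ ↓ℏ ∩ Σ_j B j}`. -/
def genStepC {n : ℕ} (h : Fin n → Cardinal) (B : Fin n → Set (Fin n → ℕ)) (i : Fin n) :
    Set (Fin n → ℕ) :=
  {y | ∃ x ∈ lowerConeC h ∩ sumset B, y = x - x i • oneAt i}

/-- The sets `ℏ^{[m]}(i)`. -/
def bracketSetC {n : ℕ} (h : Fin n → Cardinal) : ℕ → Fin n → Set (Fin n → ℕ)
  | 0 => fun i => {oneAt i}
  | m + 1 => fun i => genStepC h (bracketSetC h m) i ∪ bracketSetC h m i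

/-- The sets `ℏ^{⦃m⦄}(i)`. -/
def braceSetC {n : ℕ} (h : Fin n → Cardinal) : ℕ → Fin n → Set (Fin n → ℕ)
  | 0 => fun i => {oneAt i}
  | m + 1 => genStepC h (bracketSetC h m)

/-- `ℏ` is `0`-generating if the zero function belongs to `⋃_{i} ⋃_{m} ℏ^{⦃m⦄}(i)`. -/
def IsZeroGeneratingC {n : ℕ} (h : Fin n → Cardinal) : Prop :=
  ∃ i : Fin n, ∃ m : ℕ, (0 : Fin n → ℕ) ∈ braceSetC h m i

section Shadowing

variable {G : Type*} [Group G] {X : Type*} [Lattice X] [BoundedOrder X] [MulAction G X]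

theorem inf_finset_sup_eq_bot {ι : Type*}
    (h0dist : ∀ x y z : X, x ⊓ y = ⊥ → x ⊓ (y ⊔ z) = x ⊓ z)
    (s : Finset ι) (a : ι → X) (z : X) (h : ∀ i ∈ s, z ⊓ a i = ⊥) : z ⊓ s.sup a = ⊥ := by
  classical
  induction s using Finset.induction_on with
  | empty => simp
  | insert i s _ ih =>
    rw [Finset.sup_insert, h0dist _ _ _ (h i (Finset.mem_insert_self i s))]
    exact ih fun j hj => h j (Finset.mem_insert_of_mem hj)

/-- Every `z` disjoint from suitable translates of the `a j`, at most `f j` of them for each `j`,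
is disjoint from `u`. -/
def IsShadowedBy (G : Type*) [Group G] [MulAction G X] {n : ℕ} (a : Fin n → X) (u : X)
    (f : Fin n → ℕ) : Prop :=
  ∃ F : Fin n → Finset G, (∀ j, (F j).card ≤ f j) ∧
    ∀ z : X, (∀ j, ∀ g ∈ F j, z ⊓ g • a j = ⊥) → z ⊓ u = ⊥

theorem isShadowedBy_oneAt {n : ℕ} (a : Fin n → X) (i : Fin n) :
    IsShadowedBy G a (a i) (oneAt i) := by
  refine ⟨fun j => if j = i then {1} else ∅, fun j => ?_, fun z hz => ?_⟩
  · by_cases h : j = i <;> simp [oneAt, h]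
  · simpa using hz i 1 (by simp)

theorem IsShadowedBy.ne_zero {n : ℕ} {a : Fin n → X} {u : X} {f : Fin n → ℕ}
    (h : IsShadowedBy G a u f) (hu : u ≠ ⊥) : f ≠ 0 := by
  rintro rfl
  obtain ⟨F, hF, hz⟩ := h
  have hempty : ∀ j, F j = ∅ := fun j => by simpa using hF j
  exact hu (by simpa using hz ⊤ fun j g hg => by simp [hempty] at hg)

theorem isShadowedBy_top_of_mem_sumset {n : ℕ}
    (h0dist : ∀ x y z : X, x ⊓ y = ⊥ → x ⊓ (y ⊔ z) = x ⊓ z)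
    {a : Fin n → X} (htop : Finset.univ.sup a = ⊤) {B : Fin n → Set (Fin n → ℕ)}
    (hB : ∀ j, ∀ f ∈ B j, IsShadowedBy G a (a j) f) {x : Fin n → ℕ} (hx : x ∈ sumset B) :
    IsShadowedBy G a ⊤ x := by
  classical
  obtain ⟨b, hb, rfl⟩ := hx
  choose F hcard hF using fun j => hB j (b j) (hb j)
  refine ⟨fun k => Finset.univ.biUnion fun j => F j k, fun k => ?_, fun z hz => ?_⟩
  · rw [Finset.sum_apply]
    exact Finset.card_biUnion_le.trans (Finset.sum_le_sum fun j _ => hcard j k)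
  · rw [← htop]
    refine inf_finset_sup_eq_bot h0dist _ _ _ fun j _ => hF j z fun k g hg => hz k g ?_
    exact Finset.mem_biUnion.2 ⟨j, Finset.mem_univ j, hg⟩

theorem exists_smul_inf_smul_eq_bot
    (hinf : ∀ (g : G) (x y : X), g • (x ⊓ y) = g • x ⊓ g • y) {u : X} {F : Finset G}
    (hF : (F.card : Cardinal) <
      sInf {c : Cardinal | ∃ F : Set G, Covers F (deltaSet G u) ∧ c = Cardinal.mk F}) :
    ∃ g : G, ∀ f ∈ F, g • u ⊓ f • u = ⊥ := by
  have hnot : ¬ Covers (F : Set G) (deltaSet G u) := fun h =>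
    hF.not_ge (csInf_le' ⟨F, h, by simp⟩)
  simp only [Covers, not_forall] at hnot
  obtain ⟨g, hg⟩ := hnot
  refine ⟨g, fun f hf => ?_⟩
  by_contra hne
  refine hg ⟨f, hf, f⁻¹ * g, fun h => hne ?_, by group⟩
  have h' := congrArg (f • ·) h
  simpa only [hinf, smul_bot_of_smul_inf hinf, ← mul_smul, mul_inv_cancel_left] using h'

theorem isShadowedBy_of_isShadowedBy_top {n : ℕ}
    (hinf : ∀ (g : G) (x y : X), g • (x ⊓ y) = g • x ⊓ g • y)
    {a : Fin n → X} {x : Fin n → ℕ} (hx : IsShadowedBy G a ⊤ x) {i : Fin n}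
    (hi : (x i : Cardinal) <
      sInf {c : Cardinal | ∃ F : Set G, Covers F (deltaSet G (a i)) ∧ c = Cardinal.mk F}) :
    IsShadowedBy G a (a i) (x - x i • oneAt i) := by
  classical
  obtain ⟨F, hcard, hF⟩ := hx
  obtain ⟨g, hg⟩ := exists_smul_inf_smul_eq_bot hinf
    ((Nat.cast_le.2 (hcard i)).trans_lt hi)
  refine ⟨fun j => if j = i then ∅ else (F j).image (g⁻¹ * ·), fun j => ?_, fun z hz => ?_⟩
  · by_cases h : j = i
    · simp [h]
    · have hle : ((F j).image (g⁻¹ * ·)).card ≤ x j := Finset.card_image_le.trans (hcard j)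
      simpa only [h, oneAt, if_false, Pi.sub_apply, Pi.smul_apply, smul_zero, tsub_zero] using hle
  · have key : g • z ⊓ g • a i = ⊥ := by
      rw [← inf_top_eq (g • z ⊓ g • a i)]
      refine hF _ fun j f hf => ?_
      by_cases h : j = i
      · subst h
        rw [inf_assoc, hg f hf, inf_bot_eq]
      · have h1 : z ⊓ (g⁻¹ * f) • a j = ⊥ :=
          hz j _ (by simpa [h] using hf)
        have h2 := congrArg (g • ·) h1
        simp only [hinf, smul_bot_of_smul_inf hinf, ← mul_smul, mul_inv_cancel_left] at h2
        rw [inf_right_comm, h2, bot_inf_eq]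
    rw [← hinf] at key
    simpa only [inv_smul_smul, smul_bot_of_smul_inf hinf] using congrArg (g⁻¹ • ·) key

end Shadowing

theorem braceSetC_subset_bracketSetC {n : ℕ} (h : Fin n → Cardinal) (m : ℕ) (i : Fin n) :
    braceSetC h m i ⊆ bracketSetC h m i := by
  cases m with
  | zero => exact subset_rfl
  | succ m => exact Set.subset_union_left

/-- Theorem 2 of the paper: in a `0`-distributive bounded `G`-lattice, if
`a : Fin n → X` consists of nonzero elements with `⨆ i, a i = ⊤`, then the
cardinal-valued function `ℏ(i) = cov(Δ(a i))` is not `0`-generating. -/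
theorem not_zero_generating_of_sup_top
    {G : Type*} [Group G] {X : Type*} [Lattice X] [BoundedOrder X] [MulAction G X]
    (hbt : (⊥ : X) ≠ ⊤)
    (hsup : ∀ (g : G) (x y : X), g • (x ⊔ y) = g • x ⊔ g • y)
    (hinf : ∀ (g : G) (x y : X), g • (x ⊓ y) = g • x ⊓ g • y)
    (h0dist : ∀ x y z : X, x ⊓ y = ⊥ → x ⊓ (y ⊔ z) = x ⊓ z)
    (n : ℕ) (hn : 1 ≤ n) (a : Fin n → X) (ha : ∀ i, a i ≠ ⊥)
    (htop : Finset.univ.sup a = ⊤) :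
    ¬ IsZeroGeneratingC (fun i =>
      sInf {c : Cardinal | ∃ F : Set G, Covers F (deltaSet G (a i)) ∧ c = Cardinal.mk F}) := by
  rintro ⟨i, m, h0⟩
  have hshadow : ∀ m i, ∀ f ∈ bracketSetC (fun i =>
      sInf {c : Cardinal | ∃ F : Set G, Covers F (deltaSet G (a i)) ∧ c = Cardinal.mk F}) m i,
      IsShadowedBy G a (a i) f := by
    intro m
    induction m with
    | zero =>
      rintro i f rfl
      exact isShadowedBy_oneAt a i
    | succ m ih =>
      rintro i f (⟨x, ⟨hlow, hsum⟩, rfl⟩ | hf)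
      · exact isShadowedBy_of_isShadowedBy_top hinf
          (isShadowedBy_top_of_mem_sumset h0dist htop ih hsum) (hlow i)
      · exact ih i f hf
  exact (hshadow m i 0 (braceSetC_subset_bracketSetC _ m i h0)).ne_zero (ha i) rfl
end

section
/- Let n ≥ 2 and let ℏ : Fin n → ℕ be a constant function. Then for every permutation σ of Fin n, every m ∈ ℕ and every i ∈ Fin n: if f ∈ ℏ^{⦃m⦄}(i) then f∘σ ∈ ℏ^{⦃m⦄}(σ⁻¹(i)). -/
/-- The strict lower cone `↓ℏ`. -/
def lowerCone {n : ℕ} (h : Fin n → ℕ) : Set (Fin n → ℕ) :=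
  {g | ∀ i, g i < h i}

/-- One step of the generation process: `{x - x(i)·1_i : x ∈ ↓ℏ ∩ Σ_j B j}`. -/
def genStep {n : ℕ} (h : Fin n → ℕ) (B : Fin n → Set (Fin n → ℕ)) (i : Fin n) :
    Set (Fin n → ℕ) :=
  {y | ∃ x ∈ lowerCone h ∩ sumset B, y = x - x i • oneAt i}

/-- The sets `ℏ^{[m]}(i)`. -/
def bracketSet {n : ℕ} (h : Fin n → ℕ) : ℕ → Fin n → Set (Fin n → ℕ)
  | 0 => fun i => {oneAt i}
  | m + 1 => fun i => genStep h (bracketSet h m) i ∪ bracketSet h m i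

/-- The sets `ℏ^{⦃m⦄}(i)`. -/
def braceSet {n : ℕ} (h : Fin n → ℕ) : ℕ → Fin n → Set (Fin n → ℕ)
  | 0 => fun i => {oneAt i}
  | m + 1 => genStep h (bracketSet h m)

theorem oneAt_comp_perm {n : ℕ} (σ : Equiv.Perm (Fin n)) (i : Fin n) :
    oneAt i ∘ σ = oneAt (σ⁻¹ i) := by
  funext j
  simp [oneAt, Equiv.eq_symm_apply]

theorem sumset_comp_perm {n : ℕ} (σ : Equiv.Perm (Fin n)) {B : Fin n → Set (Fin n → ℕ)}
    (hB : ∀ i, ∀ f ∈ B i, f ∘ σ ∈ B (σ⁻¹ i)) {x : Fin n → ℕ} (hx : x ∈ sumset B) :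
    x ∘ σ ∈ sumset B := by
  obtain ⟨a, ha, rfl⟩ := hx
  refine ⟨fun j => a (σ j) ∘ σ, fun j => by simpa using hB (σ j) _ (ha (σ j)), ?_⟩
  funext k
  simpa using (Equiv.sum_comp σ fun j => a j (σ k)).symm

theorem genStep_comp_perm {n : ℕ} {h : Fin n → ℕ} (hconst : ∀ i j, h i = h j)
    (σ : Equiv.Perm (Fin n)) {B : Fin n → Set (Fin n → ℕ)}
    (hB : ∀ i, ∀ f ∈ B i, f ∘ σ ∈ B (σ⁻¹ i)) {i : Fin n} {f : Fin n → ℕ}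
    (hf : f ∈ genStep h B i) : f ∘ σ ∈ genStep h B (σ⁻¹ i) := by
  obtain ⟨x, ⟨hxh, hxB⟩, rfl⟩ := hf
  refine ⟨x ∘ σ, ⟨fun k => hconst (σ k) k ▸ hxh (σ k), sumset_comp_perm σ hB hxB⟩, ?_⟩
  rw [← oneAt_comp_perm]
  funext k
  simp

theorem bracketSet_comp_perm {n : ℕ} {h : Fin n → ℕ} (hconst : ∀ i j, h i = h j)
    (σ : Equiv.Perm (Fin n)) (m : ℕ) :
    ∀ i, ∀ f ∈ bracketSet h m i, f ∘ σ ∈ bracketSet h m (σ⁻¹ i) := by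
  induction m with
  | zero =>
    rintro i f rfl
    exact oneAt_comp_perm σ i
  | succ m ih =>
    rintro i f (hf | hf)
    · exact Or.inl (genStep_comp_perm hconst σ ih hf)
    · exact Or.inr (ih i f hf)

/-- Lemma: for a constant `ℏ` and any permutation `σ` of `Fin n`,
`f ∈ ℏ^{⦃m⦄}(i)` implies `f ∘ σ ∈ ℏ^{⦃m⦄}(σ⁻¹ i)`. -/
theorem braceSet_comp_perm (n : ℕ) (hn : 2 ≤ n)
    (h : Fin n → ℕ) (hconst : ∀ i j, h i = h j)
    (σ : Equiv.Perm (Fin n)) (m : ℕ) (i : Fin n) (f : Fin n → ℕ)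
    (hf : f ∈ braceSet h m i) :
    f ∘ σ ∈ braceSet h m (σ⁻¹ i) := by
  cases m with
  | zero =>
    obtain rfl : f = oneAt i := hf
    exact oneAt_comp_perm σ i
  | succ m => exact genStep_comp_perm hconst σ (bracketSet_comp_perm hconst σ m) hf
end

section
/- Let n ≥ 2 and let ℏ : Fin n → ℕ be a constant function. Then for every m ≥ 1: ⋃_{i∈Fin n} ℏ^{⦃m⦄}(i) ⊆ ↑ℏ^{(m]}. -/
/-- The upper set `↑A = {f : ∃ g ∈ A, g ≤ f pointwise}`. -/
def upperSet {n : ℕ} (A : Set (Fin n → ℕ)) : Set (Fin n → ℕ) :=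
  {f | ∃ g ∈ A, ∀ i, g i ≤ f i}

/-- The indicator function `1_{n∖k} : Fin n → ℕ` of `{j : k ≤ j}`. -/
def indGE (n k : ℕ) : Fin n → ℕ := fun j => if k ≤ (j : ℕ) then 1 else 0

/-- The pointwise sumset `Σ^k A` of `k` copies of `A` (with `Σ^0 A = {0}`). -/
def iterSumset {n : ℕ} (A : Set (Fin n → ℕ)) : ℕ → Set (Fin n → ℕ)
  | 0 => {0}
  | k + 1 => {x | ∃ a ∈ A, ∃ b ∈ iterSumset A k, x = a + b}

/-- The last index `n - 1` of `Fin n`. -/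
def lastIdx (n : ℕ) [NeZero n] : Fin n :=
  ⟨n - 1, Nat.sub_lt (Nat.pos_of_ne_zero (NeZero.ne n)) one_pos⟩

/-- The sets `ℏ^{(m]}`. -/
def parenSet {n : ℕ} [NeZero n] (h : Fin n → ℕ) : ℕ → Set (Fin n → ℕ)
  | 0 => ∅
  | m + 1 => parenSet h m ∪
      {y | ∃ σ : Equiv.Perm (Fin n), ∃ x : Fin n → ℕ,
        (x ∈ lowerCone h ∧
          ∃ k < n, ∃ a ∈ iterSumset (parenSet h m) k, x = indGE n k + a) ∧
        y = (x - x (lastIdx n) • oneAt (lastIdx n)) ∘ σ}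

theorem sum_mem_iterSumset {n : ℕ} {A : Set (Fin n → ℕ)} {ι : Type*} [DecidableEq ι]
    (s : Finset ι) (b : ι → Fin n → ℕ) (hb : ∀ j ∈ s, b j ∈ A) :
    ∑ j ∈ s, b j ∈ iterSumset A s.card := by
  induction s using Finset.induction_on with
  | empty => simp [iterSumset]
  | insert j s hj ih =>
    rw [Finset.sum_insert hj, Finset.card_insert_of_notMem hj]
    exact ⟨b j, hb j (Finset.mem_insert_self j s), _,
      ih fun l hl => hb l (Finset.mem_insert_of_mem hl), rfl⟩

theorem comp_perm_mem_parenSet {n : ℕ} [NeZero n] {h : Fin n → ℕ} {m : ℕ} {f : Fin n → ℕ}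
    (hf : f ∈ parenSet h m) (τ : Equiv.Perm (Fin n)) : f ∘ τ ∈ parenSet h m := by
  induction m with
  | zero => exact hf.elim
  | succ m ih =>
    rcases hf with hf | ⟨σ, x, hx, rfl⟩
    · exact Or.inl (ih hf)
    · exact Or.inr ⟨τ.trans σ, x, hx, rfl⟩

theorem upperSet_parenSet_succ {n : ℕ} [NeZero n] {h : Fin n → ℕ} {m : ℕ} {f : Fin n → ℕ}
    (hf : f ∈ upperSet (parenSet h m)) : f ∈ upperSet (parenSet h (m + 1)) := by
  obtain ⟨g, hg, hgf⟩ := hf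
  exact ⟨g, Or.inl hg, hgf⟩

theorem sub_smul_oneAt_apply {n : ℕ} (x : Fin n → ℕ) (i l : Fin n) :
    (x - x i • oneAt i) l = if l = i then 0 else x l := by
  by_cases hl : l = i
  · subst hl
    simp [oneAt]
  · simp [oneAt, hl]

/-- A set `J` of indices can be permuted onto a final segment, with a chosen element of `J` sent
to the last index. -/
theorem exists_perm_finalSegment {n : ℕ} [NeZero n] (J : Finset (Fin n)) {i : Fin n}
    (hi : i ∈ J) :
    ∃ σ : Equiv.Perm (Fin n), σ i = lastIdx n ∧ ∀ l, Jᶜ.card ≤ (σ l : ℕ) ↔ l ∈ J := by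
  have hk : Jᶜ.card < n := by
    have h1 := Finset.card_pos.mpr ⟨i, hi⟩
    have h2 := Finset.card_add_card_compl J
    rw [Fintype.card_fin] at h2
    omega
  have hcard : Fintype.card {j // j ∈ J} = Fintype.card {j : Fin n // Jᶜ.card ≤ (j : ℕ)} := by
    have h2 := Finset.card_add_card_compl J
    have h3 : Fintype.card {j : Fin n // ¬ (j : ℕ) < Jᶜ.card} = n - Jᶜ.card := by
      rw [Fintype.card_subtype_compl, Fintype.card_fin, Fintype.card_subtype,
        Fin.card_filter_val_lt, min_eq_right hk.le]
    simp only [not_lt] at h3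
    rw [h3, Fintype.card_coe]
    rw [Fintype.card_fin] at h2
    omega
  let e := Fintype.equivOfCardEq hcard
  let τ : Equiv.Perm (Fin n) := e.extendSubtype
  have hτ : ∀ l, Jᶜ.card ≤ (τ l : ℕ) ↔ l ∈ J := fun l =>
    ⟨fun hl => by_contra fun hlJ => e.extendSubtype_not_mem l hlJ hl,
      fun hl => e.extendSubtype_mem l hl⟩
  have hlast : Jᶜ.card ≤ (lastIdx n : ℕ) := by
    simp only [lastIdx]
    omega
  refine ⟨τ.trans (Equiv.swap (τ i) (lastIdx n)), by simp, fun l => ?_⟩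
  rw [← hτ l, Equiv.trans_apply, Equiv.swap_apply_def]
  split_ifs with h1 h2
  · simp [h1, hlast, (hτ i).2 hi]
  · simp [h2, hlast, (hτ i).2 hi]
  · rfl

theorem genStep_subset_upperSet_parenSet {n : ℕ} [NeZero n] {h : Fin n → ℕ}
    (hconst : ∀ i j, h i = h j) {m : ℕ} {B : Fin n → Set (Fin n → ℕ)}
    (hB : ∀ j, ∀ a ∈ B j, a = oneAt j ∨ a j = 0 ∧ a ∈ upperSet (parenSet h m)) (i : Fin n) :
    genStep h B i ⊆ upperSet (parenSet h (m + 1)) := by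
  classical
  rintro _ ⟨x, ⟨hxh, a, ha, rfl⟩, rfl⟩
  let J : Finset (Fin n) := {j | a j = oneAt j}
  by_cases hi : i ∈ J
  swap
  · obtain hai | ⟨h0, hai⟩ := hB i _ (ha i)
    · exact absurd (by simp [J, hai]) hi
    obtain ⟨g, hg, hga⟩ := upperSet_parenSet_succ hai
    refine ⟨g, hg, fun l => (hga l).trans ?_⟩
    rw [sub_smul_oneAt_apply]
    split_ifs with hl
    · rw [hl, h0]
    · rw [Finset.sum_apply]
      exact Finset.single_le_sum (f := fun j => a j l) (fun _ _ => zero_le) (Finset.mem_univ i)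
  have hup : ∀ j, ∃ g, j ∈ Jᶜ → g ∈ parenSet h m ∧ ∀ l, g l ≤ a j l := by
    intro j
    by_cases hj : j ∈ J
    · exact ⟨0, fun hj' => absurd hj (Finset.mem_compl.mp hj')⟩
    · obtain hj' | ⟨-, g, hg⟩ := hB j _ (ha j)
      · exact absurd (by simp [J, hj']) hj
      · exact ⟨g, fun _ => hg⟩
  choose b hb using hup
  obtain ⟨σ, hσi, hσ⟩ := exists_perm_finalSegment J hi
  let x' : Fin n → ℕ := indGE n Jᶜ.card + ∑ j ∈ Jᶜ, b j ∘ σ.symm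
  have hle : ∀ l, x' (σ l) ≤ (∑ j, a j) l := by
    intro l
    rw [← Finset.sum_add_sum_compl J a]
    simp only [x', Pi.add_apply, Finset.sum_apply, Function.comp_apply, Equiv.symm_apply_apply]
    refine add_le_add ?_ (Finset.sum_le_sum fun j hj => (hb j hj).2 l)
    simp only [indGE, hσ l]
    split_ifs with hl
    · have hal : a l = oneAt l := by simpa [J] using hl
      calc 1 = a l l := by simp [hal, oneAt]
        _ ≤ _ := Finset.single_le_sum (f := fun j => a j l) (fun _ _ => zero_le) hl
    · exact zero_le
  refine ⟨(x' - x' (lastIdx n) • oneAt (lastIdx n)) ∘ σ,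
    Or.inr ⟨σ, x', ⟨fun l => ?_, Jᶜ.card, ?_, _, ?_, rfl⟩, rfl⟩, fun l => ?_⟩
  · have := (hle (σ.symm l)).trans_lt (hxh (σ.symm l))
    rwa [Equiv.apply_symm_apply, hconst _ l] at this
  · exact ((hσ i).2 hi).trans_lt (σ i).isLt
  · exact sum_mem_iterSumset _ _ fun j hj => comp_perm_mem_parenSet (hb j hj).1 _
  · rw [Function.comp_apply, sub_smul_oneAt_apply, sub_smul_oneAt_apply, ← hσi]
    simp only [σ.injective.eq_iff]
    split_ifs
    · exact le_rfl
    · exact hle l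

theorem eq_oneAt_or_mem_upperSet_of_mem_bracketSet {n : ℕ} [NeZero n] {h : Fin n → ℕ}
    (hconst : ∀ i j, h i = h j) (m : ℕ) :
    ∀ i, ∀ y ∈ bracketSet h m i,
      y = oneAt i ∨ y i = 0 ∧ y ∈ upperSet (parenSet h m) := by
  induction m with
  | zero => exact fun i y hy => Or.inl hy
  | succ m ih =>
    rintro i y (hy | hy)
    · refine Or.inr ⟨?_, genStep_subset_upperSet_parenSet hconst ih i hy⟩
      obtain ⟨x, -, rfl⟩ := hy
      rw [sub_smul_oneAt_apply, if_pos rfl]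
    · exact (ih i y hy).imp_right fun hy' => ⟨hy'.1, upperSet_parenSet_succ hy'.2⟩

/-- Lemma: for a constant `ℏ` and every `m ≥ 1`,
`⋃_{i} ℏ^{⦃m⦄}(i) ⊆ ↑ℏ^{(m]}`. -/
theorem braceSet_subset_upperSet_parenSet (n : ℕ) [NeZero n] (hn : 2 ≤ n)
    (h : Fin n → ℕ) (hconst : ∀ i j, h i = h j) (m : ℕ) (hm : 1 ≤ m) :
    (⋃ i : Fin n, braceSet h m i) ⊆ upperSet (parenSet h m) := by
  obtain ⟨m, rfl⟩ := Nat.exists_eq_add_of_le' hm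
  exact Set.iUnion_subset fun i => genStep_subset_upperSet_parenSet hconst
    (eq_oneAt_or_mem_upperSet_of_mem_bracketSet hconst m) i
end
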